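/- arXiv:0708.4327 — 2 statements merged into one kernel-verified Lean document; each statement's English description precedes it below -/
import Mathlib

section
/- Let G be a torsionfree countable discrete group and H an infinite subgroup. Then there exists a subgroup K with H ≤ K ≤ G such that H is wq-normal in K and K is malnormal in G, i.e., gKg⁻¹ ∩ K = {e} for every g ∈ G \ K. -/
/-- The subgroup `gHg⁻¹ ⊓ H` of `G`. -/
def conjInter {G : Type*} [Group G] (g : G) (H : Subgroup G) : Subgroup G :=
  H.map (MulAut.conj g).toMonoidHom ⊓ H

/-- `H` is q-normal in `K` (for subgroups `H ≤ K` of an ambient group `G`):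
`H` is infinite and `K` is generated by those of its elements `g` for which
`gHg⁻¹ ∩ H` is infinite. -/
def IsQNormalIn {G : Type*} [Group G] (H K : Subgroup G) : Prop :=
  H ≤ K ∧ (H : Set G).Infinite ∧
    K = Subgroup.closure {g : G | g ∈ K ∧ ((conjInter g H : Subgroup G) : Set G).Infinite}

/-- `H` is wq-normal in `K`: there are an ordinal `α` and an increasing chain
`(f β)_{β ≤ α}` of subgroups with `f 0 = H` and `f α = K` such that for every
ordinal `γ` with `0 < γ ≤ α` the union `⋃_{β < γ} f β` is q-normal in `f γ`. -/
def IsWQNormalIn {G : Type*} [Group G] (H K : Subgroup G) : Prop :=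
  ∃ (α : Ordinal.{0}) (f : Ordinal.{0} → Subgroup G), Monotone f ∧ f 0 = H ∧ f α = K ∧
    ∀ γ : Ordinal.{0}, 0 < γ → γ ≤ α →
      IsQNormalIn (⨆ β : Ordinal.{0}, ⨆ _ : β < γ, f β) (f γ)

theorem conjInter_of_mem {G : Type*} [Group G] {g : G} {H : Subgroup G} (hg : g ∈ H) :
    conjInter g H = H := by
  refine le_antisymm inf_le_right (le_inf (fun x hx => ?_) le_rfl)
  exact ⟨g⁻¹ * x * g, H.mul_mem (H.mul_mem (H.inv_mem hg) hx) hg, by simp [mul_assoc]⟩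

/-- The subgroup generated by the elements `g` for which `gHg⁻¹ ⊓ H` is infinite. -/
def qNormalizer {G : Type*} [Group G] (H : Subgroup G) : Subgroup G :=
  Subgroup.closure {g : G | (conjInter g H : Set G).Infinite}

theorem qNormalizer_bot {G : Type*} [Group G] : qNormalizer (⊥ : Subgroup G) = ⊥ := by
  rw [qNormalizer, Subgroup.closure_eq_bot_iff]
  intro g hg
  exact absurd ((Set.finite_singleton (1 : G)).subset fun x hx => hx.2) hg

theorem le_qNormalizer {G : Type*} [Group G] {H : Subgroup G} (hH : (H : Set G).Infinite) :
    H ≤ qNormalizer H := by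
  intro g hg
  refine Subgroup.subset_closure ?_
  rwa [Set.mem_ofPred_eq, conjInter_of_mem hg]

theorem isQNormalIn_qNormalizer {G : Type*} [Group G] {H : Subgroup G}
    (hH : (H : Set G).Infinite) : IsQNormalIn H (qNormalizer H) := by
  refine ⟨le_qNormalizer hH, hH, le_antisymm ?_ ?_⟩
  · exact Subgroup.closure_mono fun g hg => ⟨Subgroup.subset_closure hg, hg⟩
  · exact Subgroup.closure_mono fun g hg => hg.2

theorem Subgroup.eq_bot_of_finite_of_torsionfree {G : Type*} [Group G]
    (htf : ∀ g : G, g ≠ 1 → ∀ n : ℕ, n ≠ 0 → g ^ n ≠ 1) {H : Subgroup G}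
    (hH : (H : Set G).Finite) : H = ⊥ := by
  have : Finite H := hH
  refine (Subgroup.eq_bot_iff_forall H).2 fun x hx => ?_
  by_contra hne
  refine htf x hne (Nat.card H) Nat.card_pos.ne' ?_
  exact congrArg Subtype.val (pow_card_eq_one' (x := (⟨x, hx⟩ : H)))

/-- The transfinite iteration of `qNormalizer` starting from `H`. -/
noncomputable def qNormalizerChain {G : Type*} [Group G] (H : Subgroup G)
    (γ : Ordinal.{0}) : Subgroup G :=
  H ⊔ qNormalizer (⨆ β : Ordinal.{0}, ⨆ _ : β < γ, qNormalizerChain H β)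
termination_by γ

theorem le_qNormalizerChain {G : Type*} [Group G] (H : Subgroup G) (γ : Ordinal.{0}) :
    H ≤ qNormalizerChain H γ := by
  rw [qNormalizerChain]
  exact le_sup_left

theorem qNormalizerChain_zero {G : Type*} [Group G] (H : Subgroup G) :
    qNormalizerChain H 0 = H := by
  rw [qNormalizerChain]
  simp [qNormalizer_bot]

theorem le_iSup_qNormalizerChain {G : Type*} [Group G] (H : Subgroup G) {β γ : Ordinal.{0}}
    (h : β < γ) :
    qNormalizerChain H β ≤ ⨆ β : Ordinal.{0}, ⨆ _ : β < γ, qNormalizerChain H β :=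
  le_iSup₂_of_le β h le_rfl

theorem iSup_qNormalizerChain_infinite {G : Type*} [Group G] {H : Subgroup G}
    (hH : (H : Set G).Infinite) {γ : Ordinal.{0}} (hγ : 0 < γ) :
    ((⨆ β : Ordinal.{0}, ⨆ _ : β < γ, qNormalizerChain H β : Subgroup G) : Set G).Infinite :=
  hH.mono ((le_qNormalizerChain H 0).trans (le_iSup_qNormalizerChain H hγ))

theorem qNormalizerChain_of_pos {G : Type*} [Group G] {H : Subgroup G}
    (hH : (H : Set G).Infinite) {γ : Ordinal.{0}} (hγ : 0 < γ) :
    qNormalizerChain H γ =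
      qNormalizer (⨆ β : Ordinal.{0}, ⨆ _ : β < γ, qNormalizerChain H β) := by
  rw [qNormalizerChain, sup_eq_right]
  exact ((le_qNormalizerChain H 0).trans (le_iSup_qNormalizerChain H hγ)).trans
    (le_qNormalizer (iSup_qNormalizerChain_infinite hH hγ))

theorem iSup_le_qNormalizerChain {G : Type*} [Group G] {H : Subgroup G}
    (hH : (H : Set G).Infinite) {γ : Ordinal.{0}} (hγ : 0 < γ) :
    (⨆ β : Ordinal.{0}, ⨆ _ : β < γ, qNormalizerChain H β) ≤ qNormalizerChain H γ := by
  rw [qNormalizerChain_of_pos hH hγ]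
  exact le_qNormalizer (iSup_qNormalizerChain_infinite hH hγ)

theorem qNormalizerChain_mono {G : Type*} [Group G] {H : Subgroup G}
    (hH : (H : Set G).Infinite) : Monotone (qNormalizerChain H) := by
  refine monotone_iff_forall_lt.2 fun β γ h => ?_
  exact (le_iSup_qNormalizerChain H h).trans
    (iSup_le_qNormalizerChain hH ((zero_le (a := β)).trans_lt h))

theorem isWQNormalIn_qNormalizerChain {G : Type*} [Group G] {H : Subgroup G}
    (hH : (H : Set G).Infinite) (α : Ordinal.{0}) : IsWQNormalIn H (qNormalizerChain H α) := by
  refine ⟨α, qNormalizerChain H, qNormalizerChain_mono hH, qNormalizerChain_zero H, rfl,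
    fun γ hγ _ => ?_⟩
  rw [qNormalizerChain_of_pos hH hγ]
  exact isQNormalIn_qNormalizer (iSup_qNormalizerChain_infinite hH hγ)

theorem exists_qNormalizer_qNormalizerChain_eq {G : Type*} [Group G] [Countable G]
    {H : Subgroup G} (hH : (H : Set G).Infinite) :
    ∃ α : Ordinal.{0}, qNormalizer (qNormalizerChain H α) = qNormalizerChain H α := by
  have : Small.{0} (Subgroup G) := small_of_injective (SetLike.coe_injective (A := Subgroup G))
  obtain ⟨a, b, hab, hlt⟩ : ∃ a b : Ordinal.{0},
      qNormalizerChain H a = qNormalizerChain H b ∧ a < b := by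
    by_contra! h
    refine not_small_ordinal.{0} (small_of_injective (f := qNormalizerChain H) fun a b hab => ?_)
    exact le_antisymm (h b a hab.symm) (h a b hab)
  have hb : 0 < b := (zero_le (a := a)).trans_lt hlt
  refine ⟨a, ?_⟩
  have hS : (⨆ β : Ordinal.{0}, ⨆ _ : β < b, qNormalizerChain H β) = qNormalizerChain H a :=
    le_antisymm ((iSup_le_qNormalizerChain hH hb).trans hab.ge) (le_iSup_qNormalizerChain H hlt)
  rw [← hS, ← qNormalizerChain_of_pos hH hb, hS, hab]

/-- In a torsionfree countable group, every infinite subgroup `H` is wq-normal in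
some malnormal subgroup `K` of `G`. -/
theorem exists_malnormal_wqnormal {G : Type*} [Group G] [Countable G]
    (htf : ∀ g : G, g ≠ 1 → ∀ n : ℕ, n ≠ 0 → g ^ n ≠ 1)
    (H : Subgroup G) (hH : (H : Set G).Infinite) :
    ∃ K : Subgroup G, H ≤ K ∧ IsWQNormalIn H K ∧
      ∀ g : G, g ∉ K → conjInter g K = ⊥ := by
  obtain ⟨α, hα⟩ := exists_qNormalizer_qNormalizerChain_eq hH
  refine ⟨qNormalizerChain H α, le_qNormalizerChain H α, isWQNormalIn_qNormalizerChain hH α,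
    fun g hg => ?_⟩
  refine Subgroup.eq_bot_of_finite_of_torsionfree htf (Set.not_infinite.1 fun hinf => hg ?_)
  rw [← hα]
  exact Subgroup.subset_closure hinf
end

section
/- Let G be a countable discrete group and H an infinite wq-normal subgroup of G. Let c : G → ℓ²G be a 1-cocycle for the left regular representation whose restriction to H is inner, i.e., there exists ξ ∈ ℓ²G with c(h) = h·ξ − ξ for all h ∈ H. Then c is inner on all of G; in fact c(g) = g·ξ − ξ for every g ∈ G. Consequently, the restriction map on first cohomology H¹(G; ℓ²G) → H¹(H; ℓ²G) is injective. -/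
open scoped ENNReal

/-- The left regular representation of a group `G` on `ℓ²G = lp (fun _ : G => ℂ) 2`:
`(lreg g f) h = f (g⁻¹ * h)`. -/
noncomputable def lreg {G : Type*} [Group G] (g : G) (f : lp (fun _ : G => ℂ) 2) :
    lp (fun _ : G => ℂ) 2 :=
  ⟨fun h => f (g⁻¹ * h), by
    show Memℓp (fun h : G => f (g⁻¹ * h)) 2
    rw [memℓp_gen_iff (by norm_num)]
    have hf : Summable fun h : G => ‖f h‖ ^ (2 : ℝ≥0∞).toReal :=
      (memℓp_gen_iff (by norm_num)).1 (lp.memℓp f)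
    exact ((Equiv.mulLeft g⁻¹).summable_iff
      (f := fun h : G => ‖f h‖ ^ (2 : ℝ≥0∞).toReal)).2 hf⟩

section LeftRegular

variable {G : Type*} [Group G]

theorem lreg_apply (g : G) (f : lp (fun _ : G => ℂ) 2) (x : G) :
    lreg g f x = f (g⁻¹ * x) := rfl

theorem lreg_one (f : lp (fun _ : G => ℂ) 2) : lreg 1 f = f := by
  ext x
  simp [lreg_apply]

theorem lreg_mul (g h : G) (f : lp (fun _ : G => ℂ) 2) :
    lreg (g * h) f = lreg g (lreg h f) := by
  ext x
  simp [lreg_apply, mul_assoc]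

theorem lreg_zero (g : G) : lreg g (0 : lp (fun _ : G => ℂ) 2) = 0 := by
  ext x
  simp [lreg_apply]

theorem lreg_sub (g : G) (f₁ f₂ : lp (fun _ : G => ℂ) 2) :
    lreg g (f₁ - f₂) = lreg g f₁ - lreg g f₂ := by
  ext x
  simp [lreg_apply]

/-- A vector of `ℓ²G` fixed by infinitely many group elements vanishes. -/
theorem eq_zero_of_infinite_lreg_eq {S : Set G} (hS : S.Infinite)
    {f : lp (fun _ : G => ℂ) 2} (hf : ∀ k ∈ S, lreg k f = f) : f = 0 := by
  ext x
  have : Infinite S := hS.to_subtype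
  have hsum : Summable fun h : G => ‖f h‖ ^ (2 : ℝ≥0∞).toReal :=
    (memℓp_gen_iff (by norm_num)).1 (lp.memℓp f)
  have hinj : Function.Injective fun k : S => (k : G)⁻¹ * x := fun a b hab =>
    Subtype.ext (inv_injective (mul_right_cancel hab))
  have hconst : Summable fun _ : S => ‖f x‖ ^ (2 : ℝ≥0∞).toReal := by
    refine (hsum.comp_injective hinj).congr fun k => ?_
    rw [Function.comp_apply, ← lreg_apply, hf k k.2]
  simpa using (summable_const_iff _).1 hconst

/-- The subgroup on which a `1`-cocycle with values in `ℓ²G` vanishes. -/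
def cocycleKernel (b : G → lp (fun _ : G => ℂ) 2)
    (hb : ∀ g h : G, b (g * h) = lreg g (b h) + b g) : Subgroup G where
  carrier := {g | b g = 0}
  one_mem' := by simpa [lreg_one] using hb 1 1
  mul_mem' {g h} hg hh := by
    simp only [Set.mem_ofPred_eq] at hg hh ⊢
    rw [hb, hg, hh, lreg_zero, add_zero]
  inv_mem' {g} hg := by
    have h1 : b 1 = 0 := by simpa [lreg_one] using hb 1 1
    simp only [Set.mem_ofPred_eq] at hg ⊢
    simpa [h1, hg, lreg_zero] using (hb g⁻¹ g).symm

theorem mem_cocycleKernel {b : G → lp (fun _ : G => ℂ) 2}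
    {hb : ∀ g h : G, b (g * h) = lreg g (b h) + b g} {g : G} :
    g ∈ cocycleKernel b hb ↔ b g = 0 := Iff.rfl

theorem IsQNormalIn.le_cocycleKernel {b : G → lp (fun _ : G => ℂ) 2}
    {hb : ∀ g h : G, b (g * h) = lreg g (b h) + b g} {H K : Subgroup G}
    (hHK : IsQNormalIn H K) (hH : H ≤ cocycleKernel b hb) : K ≤ cocycleKernel b hb := by
  rw [hHK.2.2, Subgroup.closure_le]
  rintro g ⟨-, hg⟩
  refine eq_zero_of_infinite_lreg_eq hg ?_
  rintro k ⟨⟨u, hu, hk⟩, hkH⟩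
  have hkg : k * g = g * u := by simp [← hk]
  have hmul := hb k g
  rw [hkg, hb, mem_cocycleKernel.1 (hH hu), mem_cocycleKernel.1 (hH hkH), lreg_zero,
    zero_add, add_zero] at hmul
  exact hmul.symm

theorem IsWQNormalIn.le_cocycleKernel {b : G → lp (fun _ : G => ℂ) 2}
    {hb : ∀ g h : G, b (g * h) = lreg g (b h) + b g} {H K : Subgroup G}
    (hHK : IsWQNormalIn H K) (hH : H ≤ cocycleKernel b hb) : K ≤ cocycleKernel b hb := by
  obtain ⟨α, f, -, rfl, rfl, hq⟩ := hHK
  suffices ∀ γ ≤ α, f γ ≤ cocycleKernel b hb from this α le_rfl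
  intro γ
  induction γ using WellFoundedLT.induction with
  | ind γ ih =>
    intro hγ
    rcases eq_zero_or_pos γ with rfl | hpos
    · exact hH
    · exact (hq γ hpos hγ).le_cocycleKernel
        (iSup₂_le fun β hβ => ih β hβ (hβ.le.trans hγ))

end LeftRegular

/-- A `1`-cocycle of a countable group `G` with values in `ℓ²G` which is inner on an
infinite wq-normal subgroup `H` (with witnessing vector `ξ`) is inner on all of `G`,
with the same vector `ξ`.  Consequently the restriction map
`H¹(G; ℓ²G) → H¹(H; ℓ²G)` is injective. -/
theorem cocycle_inner_of_inner_on_wqnormal {G : Type*} [Group G] [Countable G]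
    (H : Subgroup G) (hH : (H : Set G).Infinite) (hwq : IsWQNormalIn H ⊤)
    (c : G → lp (fun _ : G => ℂ) 2)
    (hc : ∀ g h : G, c (g * h) = lreg g (c h) + c g)
    (ξ : lp (fun _ : G => ℂ) 2)
    (hin : ∀ h : G, h ∈ H → c h = lreg h ξ - ξ) :
    ∀ g : G, c g = lreg g ξ - ξ := by
  have hb : ∀ g h : G, c (g * h) - (lreg (g * h) ξ - ξ) =
      lreg g (c h - (lreg h ξ - ξ)) + (c g - (lreg g ξ - ξ)) := fun g h => by
    rw [hc, lreg_mul, lreg_sub, lreg_sub]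
    abel
  have hle := hwq.le_cocycleKernel (b := fun g => c g - (lreg g ξ - ξ)) (hb := hb)
    fun h hh => sub_eq_zero.2 (hin h hh)
  exact fun g => sub_eq_zero.1 (hle (Subgroup.mem_top g))
end
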